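/- arXiv:2309.03745 — 3 statements merged into one kernel-verified Lean document; each statement's English description precedes it below -/
import Mathlib

section
/- Let (c_n)_{n≥0} be a sequence of nonnegative real numbers with c_0 = 1, let H(t) = Σ_{n≥0} c_n t^n, let ρ = limsup_{n→∞} c_n^{1/n} (a value in [0,∞]), let R be the radius of convergence of H (so R = ρ^{-1}, with R = ∞ when ρ = 0), and let R' = min(1, R). Suppose P : ℝ → ℝ is a function such that for every t ∈ (0, R') the series H(t) converges and P(t)·H(t) ≥ 1. If there exists t₀ ∈ (0,1) with P(t₀) < 0, then ρ ≥ 1/t₀; in particular R ≤ t₀ < 1. -/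
open Filter ENNReal

/-- Abstract Vinberg criterion: if the Golod–Shafarevich polynomial `P` takes a
negative value at some `t₀ ∈ (0,1)`, then the exponential growth number `ρ`
of the nonnegative power series `H(t) = Σ c_n t^n` (with `c₀ = 1`) satisfies
`ρ ≥ 1/t₀`; in particular the radius of convergence `R = ρ⁻¹` satisfies
`R ≤ t₀ < 1`. -/
theorem stmt_0 (c : ℕ → ℝ) (hc : ∀ n, 0 ≤ c n) (hc0 : c 0 = 1)
    (P : ℝ → ℝ)
    (ρ : ℝ≥0∞)
    (hρ : ρ = Filter.limsup (fun n => ENNReal.ofReal ((c n) ^ ((n : ℝ)⁻¹))) Filter.atTop)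
    (R : ℝ≥0∞) (hR : R = ρ⁻¹)
    (R' : ℝ≥0∞) (hR' : R' = min 1 R)
    (hVin : ∀ t : ℝ, 0 < t → ENNReal.ofReal t < R' →
      Summable (fun n => c n * t ^ n) ∧ 1 ≤ P t * ∑' n, c n * t ^ n)
    (t₀ : ℝ) (ht₀ : t₀ ∈ Set.Ioo (0 : ℝ) 1) (hP : P t₀ < 0) :
    ENNReal.ofReal (1 / t₀) ≤ ρ ∧ R ≤ ENNReal.ofReal t₀ := by
  have hRt : R ≤ ENNReal.ofReal t₀ := by
    by_contra! hlt
    have hlt' : ENNReal.ofReal t₀ < R' := by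
      rw [hR']
      exact lt_min (by simpa using ht₀.2) hlt
    have hH : 0 ≤ ∑' n, c n * t₀ ^ n :=
      tsum_nonneg fun n => mul_nonneg (hc n) (pow_nonneg ht₀.1.le n)
    linarith [(hVin t₀ ht₀.1 hlt').2, mul_nonpos_of_nonpos_of_nonneg hP.le hH]
  refine ⟨?_, hRt⟩
  rwa [one_div, ENNReal.ofReal_inv_of_pos ht₀.1, ENNReal.inv_le_iff_inv_le, ← hR]
end

section
/- Let p ≥ 3 be a natural number, and let A, B, C₁, C₂, C₃ be positive real numbers with A > 4B. Let D, R, R' : ℕ → ℝ be sequences such that for all n: D(n) > 0, D(n)² ≥ A·p^{2n}, D(n) ≤ C₁·p^n, |R(n) − B·p^{2n}| ≤ C₂·p^n, and 0 ≤ R'(n) ≤ C₃·p^n. Then there exists N such that for all n ≥ N, setting t_n = D(n)/(2R(n)), one has 0 < t_n < 1 and 1 − D(n)·t_n + R(n)·t_n² + R'(n)·t_n^p < 0. -/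
/-- At the vertex `D / (2R)` the quadratic `1 - D t + R t²` takes the value `1 - D² / (4R)`; this
dominates the perturbation `R' t ^ p` once the scale `x` is large. -/
theorem golodShafarevich_neg_of_large {p : ℕ} (hp : 2 ≤ p) {A B C₁ C₂ C₃ D R R' x : ℝ}
    (hB : 0 < B) (hC₂ : 0 < C₂) (hC₃ : 0 < C₃) (hD : 0 < D)
    (hDlow : A * x ^ 2 ≤ D ^ 2) (hDup : D ≤ C₁ * x) (hR : |R - B * x ^ 2| ≤ C₂ * x)
    (hR'nonneg : 0 ≤ R') (hR'up : R' ≤ C₃ * x) (hx₁ : 1 ≤ x) (hx₂ : 2 * C₂ < B * x)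
    (hx₃ : C₁ < B * x)
    (hx₄ : 4 * (C₂ + B * (C₃ * (C₁ / B) ^ 2) + C₂ * (C₃ * (C₁ / B) ^ 2)) < (A - 4 * B) * x) :
    0 < D / (2 * R) ∧ D / (2 * R) < 1 ∧
      1 - D * (D / (2 * R)) + R * (D / (2 * R)) ^ 2 + R' * (D / (2 * R)) ^ p < 0 := by
  have hx : 0 < x := by linarith
  obtain ⟨hR₁, hR₂⟩ := abs_le.mp hR
  have hRlow : B * x ^ 2 ≤ 2 * R := by nlinarith
  have hRpos : 0 < R := by nlinarith [mul_pos hB (pow_pos hx 2)]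
  have ht : 0 < D / (2 * R) := by positivity
  have htx : D / (2 * R) ≤ C₁ / B / x := by
    calc D / (2 * R) ≤ (C₁ * x) / (B * x ^ 2) := by gcongr; exact hD.le.trans hDup
      _ = C₁ / B / x := by field_simp
  have ht₁ : D / (2 * R) < 1 := by
    refine htx.trans_lt ?_
    rw [div_div, div_lt_one (by positivity)]
    exact hx₃
  refine ⟨ht, ht₁, ?_⟩
  have hquad : 1 - D * (D / (2 * R)) + R * (D / (2 * R)) ^ 2 = 1 - D ^ 2 / (4 * R) := by
    field_simp
    ring
  set E := C₃ * (C₁ / B) ^ 2 with hE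
  have hE₀ : 0 ≤ E := by positivity
  have hpert : R' * (D / (2 * R)) ^ p ≤ E / x := by
    calc R' * (D / (2 * R)) ^ p ≤ (C₃ * x) * (C₁ / B / x) ^ 2 := by
          gcongr
          exact (pow_le_pow_of_le_one ht.le ht₁.le hp).trans (pow_le_pow_left₀ ht.le htx 2)
      _ = E / x := by rw [hE]; field_simp
  have hmain : 1 + E / x < D ^ 2 / (4 * R) := by
    rw [lt_div_iff₀ (by positivity)]
    calc (1 + E / x) * (4 * R) ≤ (1 + E / x) * (4 * (B * x ^ 2 + C₂ * x)) := by
          gcongr; linarith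
      _ = 4 * B * x ^ 2 + 4 * (C₂ + B * E) * x + 4 * (C₂ * E) := by field_simp; ring
      _ ≤ 4 * B * x ^ 2 + 4 * (C₂ + B * E + C₂ * E) * x := by
          nlinarith [mul_nonneg hC₂.le hE₀]
      _ < A * x ^ 2 := by nlinarith [mul_lt_mul_of_pos_right hx₄ hx]
      _ ≤ D ^ 2 := hDlow
  linarith

/-- Analytic core of Theorem 1.2: under the stated asymptotics, for all large `n`
the point `t_n = D n / (2 R n)` lies in `(0,1)` and the majorizing
Golod–Shafarevich polynomial takes a negative value there. -/
theorem stmt_5 (p : ℕ) (hp : 3 ≤ p) (A B C₁ C₂ C₃ : ℝ)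
    (hA : 0 < A) (hB : 0 < B) (hC₁ : 0 < C₁) (hC₂ : 0 < C₂) (hC₃ : 0 < C₃)
    (hAB : A > 4 * B)
    (D R R' : ℕ → ℝ)
    (hDpos : ∀ n, 0 < D n)
    (hDlow : ∀ n, D n ^ 2 ≥ A * (p : ℝ) ^ (2 * n))
    (hDup : ∀ n, D n ≤ C₁ * (p : ℝ) ^ n)
    (hRas : ∀ n, |R n - B * (p : ℝ) ^ (2 * n)| ≤ C₂ * (p : ℝ) ^ n)
    (hR'nonneg : ∀ n, 0 ≤ R' n)
    (hR'up : ∀ n, R' n ≤ C₃ * (p : ℝ) ^ n) :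
    ∃ N : ℕ, ∀ n ≥ N,
      0 < D n / (2 * R n) ∧ D n / (2 * R n) < 1 ∧
      1 - D n * (D n / (2 * R n)) + R n * (D n / (2 * R n)) ^ 2
        + R' n * (D n / (2 * R n)) ^ p < 0 := by
  have hp₁ : (1 : ℝ) < p := by exact_mod_cast (by omega : 1 < p)
  have hlim : Filter.Tendsto (fun n : ℕ ↦ (p : ℝ) ^ n) Filter.atTop Filter.atTop :=
    tendsto_pow_atTop_atTop_of_one_lt hp₁
  rw [← Filter.eventually_atTop]
  filter_upwards [(hlim.const_mul_atTop hB).eventually_gt_atTop (2 * C₂),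
    (hlim.const_mul_atTop hB).eventually_gt_atTop C₁,
    (hlim.const_mul_atTop (sub_pos.mpr hAB)).eventually_gt_atTop
      (4 * (C₂ + B * (C₃ * (C₁ / B) ^ 2) + C₂ * (C₃ * (C₁ / B) ^ 2)))] with n h₂ h₃ h₄
  have hsq : (p : ℝ) ^ (2 * n) = ((p : ℝ) ^ n) ^ 2 := by rw [mul_comm, pow_mul]
  exact golodShafarevich_neg_of_large (by omega) hB hC₂ hC₃ (hDpos n) (hsq ▸ hDlow n) (hDup n)
    (hsq ▸ hRas n) (hR'nonneg n) (hR'up n) (one_le_pow₀ hp₁.le) h₂ h₃ h₄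
end

section
/- Let p ≥ 1 be a natural number, and let D, R', m be nonnegative real numbers and R a positive real number. Set a = D/(2(R + m + 1)). If 1 − D·a + (R + m + 1)·a² + R'·a^p ≥ 0, then m ≥ D²/4 − R − R'·D^p/(2^p·R^{p−1}) − 1. -/
/-- Key inequality in the proof of Theorem 3.6: nonnegativity of
`1 - D a + (R + m + 1) a² + R' a^p` at `a = D / (2(R + m + 1))` forces the
stated lower bound on `m`. -/
theorem stmt_7 (p : ℕ) (hp : 1 ≤ p) (D R' m : ℝ) (R : ℝ)
    (hD : 0 ≤ D) (hR' : 0 ≤ R') (hm : 0 ≤ m) (hR : 0 < R)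
    (a : ℝ) (ha : a = D / (2 * (R + m + 1)))
    (h : 1 - D * a + (R + m + 1) * a ^ 2 + R' * a ^ p ≥ 0) :
    m ≥ D ^ 2 / 4 - R - R' * D ^ p / (2 ^ p * R ^ (p - 1)) - 1 := by
  obtain ⟨k, rfl⟩ : ∃ k, p = k + 1 := ⟨p - 1, by omega⟩
  rw [Nat.add_sub_cancel]
  set S := R + m + 1 with hS
  have hS0 : 0 < S := by positivity
  have hRS : R ≤ S := by linarith
  have key : S * (1 - D * a + S * a ^ 2 + R' * a ^ (k + 1)) =
      S - D ^ 2 / 4 + R' * D ^ (k + 1) / (2 ^ (k + 1) * S ^ k) := by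
    rw [ha, div_pow, div_pow, mul_pow, mul_pow, pow_succ S k]
    field_simp
    ring
  have hmono : R' * D ^ (k + 1) / (2 ^ (k + 1) * S ^ k) ≤
      R' * D ^ (k + 1) / (2 ^ (k + 1) * R ^ k) := by
    gcongr
  have hnonneg := mul_nonneg hS0.le h
  linarith
end
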